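/- arXiv:1504.04431 — 4 statements merged into one kernel-verified Lean document; each statement's English description precedes it below -/
import Mathlib

section
/- For every positive integer m, the real Heisenberg Lie algebra 𝔥_{2m+1} is an MD-algebra and the maximal rank of its Kirillov forms is 2m. More precisely, for every linear functional F on 𝔥_{2m+1}: the rank of B_F is 0 if F(0,0,1) = 0, and the rank of B_F is 2m if F(0,0,1) ≠ 0. -/
/-- The Kirillov form associated to a linear functional `F` on a real Lie algebra `L`:
the skew-symmetric bilinear form `B_F(X, Y) = F ⁅X, Y⁆`, bundled as a linear map
`L →ₗ[ℝ] L →ₗ[ℝ] ℝ`. -/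
def kirillovForm {L : Type*} [LieRing L] [LieAlgebra ℝ L] (F : Module.Dual ℝ L) :
    L →ₗ[ℝ] L →ₗ[ℝ] ℝ :=
  LinearMap.mk₂ ℝ (fun X Y => F ⁅X, Y⁆)
    (fun X X' Y => by simp)
    (fun c X Y => by simp)
    (fun X Y Y' => by simp)
    (fun c X Y => by simp)

/-- The rank of the Kirillov form `B_F`. -/
noncomputable def kirillovRank {L : Type*} [LieRing L] [LieAlgebra ℝ L]
    (F : Module.Dual ℝ L) : ℕ :=
  Module.finrank ℝ (LinearMap.range (kirillovForm F))

/-- A real Lie algebra is an MD-algebra if all Kirillov forms `B_F` of nonzero rank have the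
same rank. -/
def IsMDAlgebra (L : Type*) [LieRing L] [LieAlgebra ℝ L] : Prop :=
  ∀ F G : Module.Dual ℝ L, kirillovRank F ≠ 0 → kirillovRank G ≠ 0 →
    kirillovRank F = kirillovRank G

def Heisenberg (m : ℕ) : Type := (Fin m → ℝ) × (Fin m → ℝ) × ℝ

namespace Heisenberg
variable {m : ℕ}

noncomputable instance : AddCommGroup (Heisenberg m) :=
  inferInstanceAs (AddCommGroup ((Fin m → ℝ) × (Fin m → ℝ) × ℝ))
noncomputable instance : Module ℝ (Heisenberg m) :=
  inferInstanceAs (Module ℝ ((Fin m → ℝ) × (Fin m → ℝ) × ℝ))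

noncomputable instance : LieRing (Heisenberg m) where
  bracket x y := (0, 0, ∑ i, (x.1 i * y.2.1 i - y.1 i * x.2.1 i))
  add_lie x y z := by
    refine Prod.ext ?_ (Prod.ext ?_ ?_)
    · show (0 : Fin m → ℝ) = 0 + 0; simp
    · show (0 : Fin m → ℝ) = 0 + 0; simp
    · show (∑ i, ((x + y).1 i * z.2.1 i - z.1 i * (x + y).2.1 i)) =
        (∑ i, (x.1 i * z.2.1 i - z.1 i * x.2.1 i)) + (∑ i, (y.1 i * z.2.1 i - z.1 i * y.2.1 i))
      rw [← Finset.sum_add_distrib]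
      refine Finset.sum_congr rfl fun i _ => ?_
      show ((x.1 + y.1) i * z.2.1 i - z.1 i * ((x.2.1 + y.2.1)) i) = _
      simp only [Pi.add_apply]; ring
  lie_add x y z := by
    refine Prod.ext ?_ (Prod.ext ?_ ?_)
    · show (0 : Fin m → ℝ) = 0 + 0; simp
    · show (0 : Fin m → ℝ) = 0 + 0; simp
    · show (∑ i, (x.1 i * (y + z).2.1 i - (y + z).1 i * x.2.1 i)) =
        (∑ i, (x.1 i * y.2.1 i - y.1 i * x.2.1 i)) + (∑ i, (x.1 i * z.2.1 i - z.1 i * x.2.1 i))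
      rw [← Finset.sum_add_distrib]
      refine Finset.sum_congr rfl fun i _ => ?_
      show (x.1 i * ((y.2.1 + z.2.1)) i - ((y.1 + z.1)) i * x.2.1 i) = _
      simp only [Pi.add_apply]; ring
  lie_self x := by
    refine Prod.ext ?_ (Prod.ext ?_ ?_)
    · show (0 : Fin m → ℝ) = 0; rfl
    · show (0 : Fin m → ℝ) = 0; rfl
    · show (∑ i, (x.1 i * x.2.1 i - x.1 i * x.2.1 i)) = 0
      simp
  leibniz_lie x y z := by
    refine Prod.ext ?_ (Prod.ext ?_ ?_)
    · show (0 : Fin m → ℝ) = 0 + 0; simp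
    · show (0 : Fin m → ℝ) = 0 + 0; simp
    · show (∑ i, (x.1 i * (0:Fin m → ℝ) i - (0:Fin m → ℝ) i * x.2.1 i)) =
        (∑ i, ((0:Fin m → ℝ) i * z.2.1 i - z.1 i * (0:Fin m → ℝ) i)) +
        (∑ i, (y.1 i * (0:Fin m → ℝ) i - (0:Fin m → ℝ) i * y.2.1 i))
      simp

noncomputable instance : LieAlgebra ℝ (Heisenberg m) where
  lie_smul c x y := by
    refine Prod.ext ?_ (Prod.ext ?_ ?_)
    · show (0 : Fin m → ℝ) = c • 0; simp
    · show (0 : Fin m → ℝ) = c • 0; simp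
    · show (∑ i, (x.1 i * (c • y).2.1 i - (c • y).1 i * x.2.1 i)) =
        c • (∑ i, (x.1 i * y.2.1 i - y.1 i * x.2.1 i))
      rw [Finset.smul_sum]
      refine Finset.sum_congr rfl fun i _ => ?_
      show (x.1 i * (c • y.2.1) i - (c • y.1) i * x.2.1 i) = _
      simp only [Pi.smul_apply, smul_eq_mul]; ring

end Heisenberg

namespace Heisenberg

/-- The central element `(0, 0, 1)` of the Heisenberg Lie algebra. -/
def central (m : ℕ) : Heisenberg m := (0, 0, 1)

theorem kirillovForm_apply {m : ℕ} (F : Module.Dual ℝ (Heisenberg m)) (X Y : Heisenberg m) :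
    kirillovForm F X Y = (∑ i, (X.1 i * Y.2.1 i - Y.1 i * X.2.1 i)) * F (central m) := by
  have h : (⁅X, Y⁆ : Heisenberg m) =
      (∑ i, (X.1 i * Y.2.1 i - Y.1 i * X.2.1 i)) • central m := by
    refine Prod.ext ?_ (Prod.ext ?_ ?_)
    · exact (smul_zero (A := Fin m → ℝ) _).symm
    · exact (smul_zero (A := Fin m → ℝ) _).symm
    · exact (mul_one (∑ i, (X.1 i * Y.2.1 i - Y.1 i * X.2.1 i))).symm
  change F ⁅X, Y⁆ = _
  rw [h, LinearMap.map_smul, smul_eq_mul]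

instance (m : ℕ) : Module.Finite ℝ (Heisenberg m) :=
  inferInstanceAs (Module.Finite ℝ ((Fin m → ℝ) × (Fin m → ℝ) × ℝ))

theorem finrank_eq (m : ℕ) : Module.finrank ℝ (Heisenberg m) = 2 * m + 1 := by
  change Module.finrank ℝ ((Fin m → ℝ) × (Fin m → ℝ) × ℝ) = 2 * m + 1
  simp only [Module.finrank_prod, Module.finrank_fin_fun, Module.finrank_self]
  ring

theorem ker_kirillovForm {m : ℕ} (F : Module.Dual ℝ (Heisenberg m)) (hF : F (central m) ≠ 0) :
    LinearMap.ker (kirillovForm F) = Submodule.span ℝ {central m} := by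
  ext X
  rw [LinearMap.mem_ker, Submodule.mem_span_singleton]
  constructor
  · intro h
    have key (Y : Heisenberg m) : ∑ i, (X.1 i * Y.2.1 i - Y.1 i * X.2.1 i) = 0 := by
      have hY := kirillovForm_apply F X Y
      rw [h, LinearMap.zero_apply] at hY
      exact (mul_eq_zero.mp hY.symm).resolve_right hF
    refine ⟨X.2.2, Prod.ext ?_ (Prod.ext ?_ ?_)⟩
    · refine (smul_zero (A := Fin m → ℝ) _).trans (funext fun i => ?_)
      have := key (0, Pi.single i 1, 0)
      simpa [Pi.single_apply] using this.symm
    · refine (smul_zero (A := Fin m → ℝ) _).trans (funext fun i => ?_)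
      have := key (Pi.single i 1, 0, 0)
      simpa [Pi.single_apply, eq_comm] using this
    · exact mul_one X.2.2
  · rintro ⟨c, rfl⟩
    rw [map_smul]
    have : kirillovForm F (central m) = 0 := by
      ext Y
      rw [kirillovForm_apply]
      simp [central]
    rw [this, smul_zero]

theorem kirillovRank_of_eq_zero {m : ℕ} (F : Module.Dual ℝ (Heisenberg m))
    (hF : F (central m) = 0) : kirillovRank F = 0 := by
  have : kirillovForm F = 0 := by
    ext X Y
    rw [kirillovForm_apply, hF, mul_zero]
    rfl
  rw [kirillovRank, this, LinearMap.range_zero, finrank_bot]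

theorem kirillovRank_of_ne_zero {m : ℕ} (F : Module.Dual ℝ (Heisenberg m))
    (hF : F (central m) ≠ 0) : kirillovRank F = 2 * m := by
  have hz : central m ≠ 0 := fun h => hF (by rw [h, map_zero])
  have h := LinearMap.finrank_range_add_finrank_ker (kirillovForm F)
  rw [ker_kirillovForm F hF, finrank_span_singleton hz, finrank_eq] at h
  exact Nat.add_right_cancel h

/-- The functional dual to the central element `(0, 0, 1)`. -/
def centralCoord (m : ℕ) : Module.Dual ℝ (Heisenberg m) where
  toFun X := X.2.2
  map_add' _ _ := rfl
  map_smul' _ _ := rfl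

end Heisenberg

/-- For every positive integer `m`, the real Heisenberg Lie algebra
`𝔥_{2m+1}` is an MD-algebra and the maximal rank of its Kirillov forms is `2m`; more
precisely, for every `F` in the dual, `B_F` has rank `0` if `F(0,0,1) = 0` and rank `2m` if
`F(0,0,1) ≠ 0`. -/
theorem heisenberg_isMDAlgebra (m : ℕ) (hm : 0 < m) :
    IsMDAlgebra (Heisenberg m) ∧
    IsGreatest (Set.range fun F : Module.Dual ℝ (Heisenberg m) => kirillovRank F) (2 * m) ∧
    ∀ F : Module.Dual ℝ (Heisenberg m),
      (F (0, 0, 1) = 0 → kirillovRank F = 0) ∧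
      (F (0, 0, 1) ≠ 0 → kirillovRank F = 2 * m) := by
  have h0 := Heisenberg.kirillovRank_of_eq_zero (m := m)
  have h1 := Heisenberg.kirillovRank_of_ne_zero (m := m)
  refine ⟨fun F G hF hG => ?_, ⟨⟨Heisenberg.centralCoord m, h1 _ one_ne_zero⟩, ?_⟩,
    fun F => ⟨h0 F, h1 F⟩⟩
  · rw [h1 F fun h => hF (h0 F h), h1 G fun h => hG (h0 G h)]
  · rintro _ ⟨F, rfl⟩
    by_cases hF : F (0, 0, 1) = 0
    · exact (h0 F hF).trans_le (Nat.zero_le _)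
    · exact (h1 F hF).le
end

section
/- For every positive integer m, the (2m+2)-dimensional real Diamond Lie algebra ℝ.𝔥_{2m+1} is an MD-algebra if and only if m = 1. That is, the 4-dimensional real Diamond Lie algebra is an MD-algebra, while for every natural number m > 1 the (2m+2)-dimensional real Diamond Lie algebra is not an MD-algebra. -/
/-- The `(2m+2)`-dimensional real Diamond Lie algebra, as the vector space
`(Fin m → ℝ) × (Fin m → ℝ) × ℝ × ℝ`. -/
def Diamond (m : ℕ) : Type := (Fin m → ℝ) × (Fin m → ℝ) × ℝ × ℝ

namespace Diamond
variable {m : ℕ}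

noncomputable instance : AddCommGroup (Diamond m) :=
  inferInstanceAs (AddCommGroup ((Fin m → ℝ) × (Fin m → ℝ) × ℝ × ℝ))
noncomputable instance : Module ℝ (Diamond m) :=
  inferInstanceAs (Module ℝ ((Fin m → ℝ) × (Fin m → ℝ) × ℝ × ℝ))

/-- The bracket `[(x,y,z,t),(x',y',z',t')] = (t'•x - t•x', t•y' - t'•y, ∑ i, (x i * y' i - x' i * y i), 0)`. -/
noncomputable def br (a b : Diamond m) : Diamond m :=
  (b.2.2.2 • a.1 - a.2.2.2 • b.1, a.2.2.2 • b.2.1 - b.2.2.2 • a.2.1,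
    ∑ i, (a.1 i * b.2.1 i - b.1 i * a.2.1 i), 0)

noncomputable instance : LieRing (Diamond m) where
  bracket := br
  add_lie x y z := by
    show br (x + y) z = br x z + br y z
    refine Prod.ext ?_ (Prod.ext ?_ (Prod.ext ?_ ?_))
    · show z.2.2.2 • (x.1 + y.1) - (x.2.2.2 + y.2.2.2) • z.1 =
        (z.2.2.2 • x.1 - x.2.2.2 • z.1) + (z.2.2.2 • y.1 - y.2.2.2 • z.1)
      funext i
      simp only [Pi.add_apply, Pi.sub_apply, Pi.smul_apply, smul_eq_mul]; ring
    · show (x.2.2.2 + y.2.2.2) • z.2.1 - z.2.2.2 • (x.2.1 + y.2.1) =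
        (x.2.2.2 • z.2.1 - z.2.2.2 • x.2.1) + (y.2.2.2 • z.2.1 - z.2.2.2 • y.2.1)
      funext i
      simp only [Pi.add_apply, Pi.sub_apply, Pi.smul_apply, smul_eq_mul]; ring
    · show (∑ i, ((x.1 + y.1) i * z.2.1 i - z.1 i * (x.2.1 + y.2.1) i)) =
        (∑ i, (x.1 i * z.2.1 i - z.1 i * x.2.1 i)) + (∑ i, (y.1 i * z.2.1 i - z.1 i * y.2.1 i))
      rw [← Finset.sum_add_distrib]
      exact Finset.sum_congr rfl fun i _ => by simp only [Pi.add_apply]; ring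
    · show (0 : ℝ) = 0 + 0; simp
  lie_add x y z := by
    show br x (y + z) = br x y + br x z
    refine Prod.ext ?_ (Prod.ext ?_ (Prod.ext ?_ ?_))
    · show (y.2.2.2 + z.2.2.2) • x.1 - x.2.2.2 • (y.1 + z.1) =
        (y.2.2.2 • x.1 - x.2.2.2 • y.1) + (z.2.2.2 • x.1 - x.2.2.2 • z.1)
      funext i
      simp only [Pi.add_apply, Pi.sub_apply, Pi.smul_apply, smul_eq_mul]; ring
    · show x.2.2.2 • (y.2.1 + z.2.1) - (y.2.2.2 + z.2.2.2) • x.2.1 =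
        (x.2.2.2 • y.2.1 - y.2.2.2 • x.2.1) + (x.2.2.2 • z.2.1 - z.2.2.2 • x.2.1)
      funext i
      simp only [Pi.add_apply, Pi.sub_apply, Pi.smul_apply, smul_eq_mul]; ring
    · show (∑ i, (x.1 i * (y.2.1 + z.2.1) i - (y.1 + z.1) i * x.2.1 i)) =
        (∑ i, (x.1 i * y.2.1 i - y.1 i * x.2.1 i)) + (∑ i, (x.1 i * z.2.1 i - z.1 i * x.2.1 i))
      rw [← Finset.sum_add_distrib]
      exact Finset.sum_congr rfl fun i _ => by simp only [Pi.add_apply]; ring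
    · show (0 : ℝ) = 0 + 0; simp
  lie_self x := by
    show br x x = 0
    refine Prod.ext ?_ (Prod.ext ?_ (Prod.ext ?_ ?_))
    · show x.2.2.2 • x.1 - x.2.2.2 • x.1 = 0; simp
    · show x.2.2.2 • x.2.1 - x.2.2.2 • x.2.1 = 0; simp
    · show (∑ i, (x.1 i * x.2.1 i - x.1 i * x.2.1 i)) = 0; simp
    · rfl
  leibniz_lie x y z := by
    show br x (br y z) = br (br x y) z + br y (br x z)
    refine Prod.ext ?_ (Prod.ext ?_ (Prod.ext ?_ ?_))
    · show (0:ℝ) • x.1 - x.2.2.2 • (z.2.2.2 • y.1 - y.2.2.2 • z.1) =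
        (z.2.2.2 • (y.2.2.2 • x.1 - x.2.2.2 • y.1) - (0:ℝ) • z.1) +
        ((0:ℝ) • y.1 - y.2.2.2 • (z.2.2.2 • x.1 - x.2.2.2 • z.1))
      funext i
      simp only [Pi.sub_apply, Pi.smul_apply, Pi.add_apply, smul_eq_mul]; ring
    · show x.2.2.2 • (y.2.2.2 • z.2.1 - z.2.2.2 • y.2.1) - (0:ℝ) • x.2.1 =
        ((0:ℝ) • z.2.1 - z.2.2.2 • (x.2.2.2 • y.2.1 - y.2.2.2 • x.2.1)) +
        (y.2.2.2 • (x.2.2.2 • z.2.1 - z.2.2.2 • x.2.1) - (0:ℝ) • y.2.1)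
      funext i
      simp only [Pi.sub_apply, Pi.smul_apply, Pi.add_apply, smul_eq_mul]; ring
    · show (∑ i, (x.1 i * (y.2.2.2 • z.2.1 - z.2.2.2 • y.2.1) i -
          (z.2.2.2 • y.1 - y.2.2.2 • z.1) i * x.2.1 i)) =
        (∑ i, ((y.2.2.2 • x.1 - x.2.2.2 • y.1) i * z.2.1 i -
          z.1 i * (x.2.2.2 • y.2.1 - y.2.2.2 • x.2.1) i)) +
        (∑ i, (y.1 i * (x.2.2.2 • z.2.1 - z.2.2.2 • x.2.1) i -
          (z.2.2.2 • x.1 - x.2.2.2 • z.1) i * y.2.1 i))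
      rw [← Finset.sum_add_distrib]
      refine Finset.sum_congr rfl fun i _ => ?_
      simp only [Pi.sub_apply, Pi.smul_apply, smul_eq_mul]; ring
    · show (0:ℝ) = 0 + 0; simp

noncomputable instance : LieAlgebra ℝ (Diamond m) where
  lie_smul c x y := by
    show br x (c • y) = c • br x y
    refine Prod.ext ?_ (Prod.ext ?_ (Prod.ext ?_ ?_))
    · show (c • y.2.2.2) • x.1 - x.2.2.2 • (c • y.1) =
        c • (y.2.2.2 • x.1 - x.2.2.2 • y.1)
      funext i
      simp only [Pi.sub_apply, Pi.smul_apply, smul_eq_mul]; ring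
    · show x.2.2.2 • (c • y.2.1) - (c • y.2.2.2) • x.2.1 =
        c • (x.2.2.2 • y.2.1 - y.2.2.2 • x.2.1)
      funext i
      simp only [Pi.sub_apply, Pi.smul_apply, smul_eq_mul]; ring
    · show (∑ i, (x.1 i * (c • y.2.1) i - (c • y.1) i * x.2.1 i)) =
        c • (∑ i, (x.1 i * y.2.1 i - y.1 i * x.2.1 i))
      rw [Finset.smul_sum]
      refine Finset.sum_congr rfl fun i _ => ?_
      simp only [Pi.smul_apply, smul_eq_mul]; ring
    · show (0:ℝ) = c • 0; simp

end Diamond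

theorem kirillovForm_apply {L : Type*} [LieRing L] [LieAlgebra ℝ L] (F : Module.Dual ℝ L)
    (X Y : L) : kirillovForm F X Y = F ⁅X, Y⁆ := rfl

/-- A nonzero Kirillov form has rank at least two, because it is alternating. -/
theorem two_le_kirillovRank {L : Type*} [LieRing L] [LieAlgebra ℝ L] [FiniteDimensional ℝ L]
    {F : Module.Dual ℝ L} {X Y : L} (h : F ⁅X, Y⁆ ≠ 0) : 2 ≤ kirillovRank F := by
  have hli : LinearIndependent ℝ ![kirillovForm F X, kirillovForm F Y] := by
    rw [LinearIndependent.pair_iff]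
    intro a b hab
    have hX := LinearMap.congr_fun hab X
    have hY := LinearMap.congr_fun hab Y
    simp only [LinearMap.add_apply, LinearMap.smul_apply, kirillovForm_apply, lie_self, map_zero,
      smul_eq_mul, mul_zero, zero_add, add_zero, LinearMap.zero_apply, mul_eq_zero, h,
      or_false] at hX hY
    rw [← lie_skew, map_neg, neg_eq_zero] at hX
    exact ⟨hY, hX.resolve_right h⟩
  have hle : Submodule.span ℝ (Set.range ![kirillovForm F X, kirillovForm F Y]) ≤
      LinearMap.range (kirillovForm F) := by
    rw [Submodule.span_le]
    rintro _ ⟨i, rfl⟩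
    fin_cases i
    exacts [⟨X, rfl⟩, ⟨Y, rfl⟩]
  calc 2 = Module.finrank ℝ (Submodule.span ℝ (Set.range ![kirillovForm F X, kirillovForm F Y])) :=
        (finrank_span_eq_card hli).symm
    _ ≤ kirillovRank F := Submodule.finrank_mono hle

theorem exists_lie_ne_zero_of_kirillovRank_ne_zero {L : Type*} [LieRing L] [LieAlgebra ℝ L]
    {F : Module.Dual ℝ L} (h : kirillovRank F ≠ 0) : ∃ X Y : L, F ⁅X, Y⁆ ≠ 0 := by
  by_contra! h0
  have hF : kirillovForm F = 0 := LinearMap.ext fun X => LinearMap.ext fun Y => h0 X Y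
  exact h (by rw [kirillovRank, hF, LinearMap.range_zero, finrank_bot])

namespace Diamond

instance (m : ℕ) : FiniteDimensional ℝ (Diamond m) :=
  inferInstanceAs (FiniteDimensional ℝ ((Fin m → ℝ) × (Fin m → ℝ) × ℝ × ℝ))

theorem finrank_eq (m : ℕ) : Module.finrank ℝ (Diamond m) = 2 * m + 2 := by
  change Module.finrank ℝ ((Fin m → ℝ) × (Fin m → ℝ) × ℝ × ℝ) = _
  simp only [Module.finrank_prod, Module.finrank_fin_fun, Module.finrank_self]
  ring

theorem lie_def {m : ℕ} (a b : Diamond m) :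
    ⁅a, b⁆ = (b.2.2.2 • a.1 - a.2.2.2 • b.1, a.2.2.2 • b.2.1 - b.2.2.2 • a.2.1,
      ∑ i, (a.1 i * b.2.1 i - b.1 i * a.2.1 i), 0) := rfl

/-- The coordinate functional `(x, y, z, t) ↦ z`. -/
def zCoord (m : ℕ) : Module.Dual ℝ (Diamond m) where
  toFun a := a.2.2.1
  map_add' _ _ := rfl
  map_smul' _ _ := rfl

/-- The coordinate functional `(x, y, z, t) ↦ t`. -/
def tCoord (m : ℕ) : Module.Dual ℝ (Diamond m) where
  toFun a := a.2.2.2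
  map_add' _ _ := rfl
  map_smul' _ _ := rfl

/-- The coordinate functional `(x, y, z, t) ↦ x i`. -/
def xCoord {m : ℕ} (i : Fin m) : Module.Dual ℝ (Diamond m) where
  toFun a := a.1 i
  map_add' _ _ := rfl
  map_smul' _ _ := rfl

/-- The inclusion `(x, y) ↦ (x, y, 0, 0)`. -/
def inclXY (m : ℕ) : (Fin m → ℝ) × (Fin m → ℝ) →ₗ[ℝ] Diamond m where
  toFun p := (p.1, p.2, 0, 0)
  map_add' p q := show _ = ((p.1 + q.1, p.2 + q.2, 0 + 0, 0 + 0) :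
    (Fin m → ℝ) × (Fin m → ℝ) × ℝ × ℝ) by simp
  map_smul' c p := show _ = ((c • p.1, c • p.2, c • 0, c • 0) :
    (Fin m → ℝ) × (Fin m → ℝ) × ℝ × ℝ) by simp

theorem two_mul_le_kirillovRank_zCoord (m : ℕ) : 2 * m ≤ kirillovRank (zCoord m) := by
  have hinj : Function.Injective (kirillovForm (zCoord m) ∘ₗ inclXY m) := by
    rw [← LinearMap.ker_eq_bot, LinearMap.ker_eq_bot']
    rintro ⟨x, y⟩ h
    have key (x' y' : Fin m → ℝ) : ∑ i, (x i * y' i - x' i * y i) = 0 :=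
      LinearMap.congr_fun h (inclXY m (x', y'))
    refine Prod.ext (funext fun j => ?_) (funext fun j => ?_)
    · simpa [Pi.single_apply] using key 0 (Pi.single j 1)
    · simpa [Pi.single_apply] using key (Pi.single j 1) 0
  calc 2 * m = Module.finrank ℝ ((Fin m → ℝ) × (Fin m → ℝ)) := by
        simp only [Module.finrank_prod, Module.finrank_fin_fun]; ring
    _ = Module.finrank ℝ (LinearMap.range (kirillovForm (zCoord m) ∘ₗ inclXY m)) :=
        (LinearMap.finrank_range_of_inj hinj).symm
    _ ≤ kirillovRank (zCoord m) :=
        Submodule.finrank_mono (LinearMap.range_comp_le_range _ _)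

theorem kirillovRank_xCoord {m : ℕ} (i : Fin m) : kirillovRank (xCoord i) = 2 := by
  apply le_antisymm
  · have hle : LinearMap.range (kirillovForm (xCoord i)) ≤
        Submodule.span ℝ (Set.range ![tCoord m, xCoord i]) := by
      rintro _ ⟨a, rfl⟩
      have ha : kirillovForm (xCoord i) a = a.1 i • tCoord m + (-a.2.2.2) • xCoord i := by
        refine LinearMap.ext fun b => ?_
        change b.2.2.2 * a.1 i - a.2.2.2 * b.1 i = a.1 i * b.2.2.2 + -a.2.2.2 * b.1 i
        ring
      rw [ha]
      exact add_mem (Submodule.smul_mem _ _ (Submodule.subset_span ⟨0, rfl⟩))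
        (Submodule.smul_mem _ _ (Submodule.subset_span ⟨1, rfl⟩))
    exact (Submodule.finrank_mono hle).trans (finrank_range_le_card _)
  · refine two_le_kirillovRank (X := ((Pi.single i 1, 0, 0, 0) : Diamond m))
      (Y := ((0, 0, 0, 1) : Diamond m)) ?_
    change (1 : ℝ) * (Pi.single i 1 : Fin m → ℝ) i - 0 * 0 ≠ 0
    simp

/-- The element `(x, y, z, t)` of the four-dimensional Diamond Lie algebra. -/
def mk₁ (x y z t : ℝ) : Diamond 1 := (fun _ => x, fun _ => y, z, t)

theorem exists_eq_mk₁ (a : Diamond 1) : ∃ x y z t, a = mk₁ x y z t :=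
  ⟨a.1 0, a.2.1 0, a.2.2.1, a.2.2.2, Prod.ext (funext fun i => by rw [Subsingleton.elim i 0]; rfl)
    (Prod.ext (funext fun i => by rw [Subsingleton.elim i 0]; rfl) rfl)⟩

theorem smul_mk₁ (c x y z t : ℝ) :
    c • mk₁ x y z t = mk₁ (c * x) (c * y) (c * z) (c * t) := rfl

theorem add_mk₁ (x y z t x' y' z' t' : ℝ) :
    mk₁ x y z t + mk₁ x' y' z' t' = mk₁ (x + x') (y + y') (z + z') (t + t') := rfl

theorem mk₁_eq_zero {x y z t : ℝ} : mk₁ x y z t = 0 ↔ x = 0 ∧ y = 0 ∧ z = 0 ∧ t = 0 := by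
  constructor
  · intro h
    exact ⟨congrArg (fun a : Diamond 1 => a.1 0) h, congrArg (fun a : Diamond 1 => a.2.1 0) h,
      congrArg (fun a : Diamond 1 => a.2.2.1) h, congrArg (fun a : Diamond 1 => a.2.2.2) h⟩
  · rintro ⟨rfl, rfl, rfl, rfl⟩
    rfl

theorem lie_mk₁ (x y z t x' y' z' t' : ℝ) :
    ⁅mk₁ x y z t, mk₁ x' y' z' t'⁆ =
      mk₁ (t' * x - t * x') (t * y' - t' * y) (x * y' - x' * y) 0 := by
  rw [lie_def]
  simp only [mk₁, Fin.sum_univ_one]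
  rfl

theorem apply_mk₁ (F : Module.Dual ℝ (Diamond 1)) (x y z t : ℝ) :
    F (mk₁ x y z t) = x * F (mk₁ 1 0 0 0) + y * F (mk₁ 0 1 0 0) + z * F (mk₁ 0 0 1 0) +
      t * F (mk₁ 0 0 0 1) := by
  simp only [← smul_eq_mul, ← map_smul, ← map_add, smul_mk₁, add_mk₁]
  simp

/-- The kernel of `B_F` contains the central element `(0, 0, 1, 0)` and
`(-F e_y, -F e_x, 0, F e_z)`. -/
theorem kirillovRank_le_two {F : Module.Dual ℝ (Diamond 1)} (h : kirillovRank F ≠ 0) :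
    kirillovRank F ≤ 2 := by
  obtain ⟨X, Y, hXY⟩ := exists_lie_ne_zero_of_kirillovRank_ne_zero h
  obtain ⟨x, y, z, t, rfl⟩ := exists_eq_mk₁ X
  obtain ⟨x', y', z', t', rfl⟩ := exists_eq_mk₁ Y
  rw [lie_mk₁, apply_mk₁] at hXY
  have hker {p q r s : ℝ} (hp : ∀ x y z t, F ⁅mk₁ p q r s, mk₁ x y z t⁆ = 0) :
      mk₁ p q r s ∈ LinearMap.ker (kirillovForm F) := by
    refine LinearMap.mem_ker.mpr (LinearMap.ext fun b => ?_)
    obtain ⟨x, y, z, t, rfl⟩ := exists_eq_mk₁ b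
    exact hp x y z t
  have hv : mk₁ (-F (mk₁ 0 1 0 0)) (-F (mk₁ 1 0 0 0)) 0 (F (mk₁ 0 0 1 0)) ∈
      LinearMap.ker (kirillovForm F) := hker fun x y z t => by
    rw [lie_mk₁, apply_mk₁]; ring
  have hz : mk₁ 0 0 1 0 ∈ LinearMap.ker (kirillovForm F) := hker fun x y z t => by
    rw [lie_mk₁, apply_mk₁]; ring
  have hli : LinearIndependent ℝ ![(⟨_, hv⟩ : LinearMap.ker (kirillovForm F)), ⟨_, hz⟩] := by
    refine LinearIndependent.pair_iff.mpr ?_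
    intro a b hab
    have hab' := congrArg Subtype.val hab
    change a • mk₁ _ _ _ _ + b • mk₁ _ _ _ _ = 0 at hab'
    rw [smul_mk₁, smul_mk₁, add_mk₁, mk₁_eq_zero] at hab'
    obtain ⟨h1, h2, h3, h4⟩ := hab'
    refine ⟨?_, by linarith⟩
    by_contra ha
    have hy : F (mk₁ 0 1 0 0) = 0 := by simpa [ha] using h1
    have hx : F (mk₁ 1 0 0 0) = 0 := by simpa [ha] using h2
    have hz : F (mk₁ 0 0 1 0) = 0 := by simpa [ha] using h4
    simp [hx, hy, hz] at hXY
  have h2 : 2 ≤ Module.finrank ℝ (LinearMap.ker (kirillovForm F)) := by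
    simpa using hli.fintype_card_le_finrank
  have hsum := LinearMap.finrank_range_add_finrank_ker (kirillovForm F)
  rw [finrank_eq] at hsum
  rw [kirillovRank]
  omega

theorem kirillovRank_eq_two {F : Module.Dual ℝ (Diamond 1)} (h : kirillovRank F ≠ 0) :
    kirillovRank F = 2 := by
  obtain ⟨X, Y, hXY⟩ := exists_lie_ne_zero_of_kirillovRank_ne_zero h
  exact le_antisymm (kirillovRank_le_two h) (two_le_kirillovRank hXY)

end Diamond

/-- For every positive integer `m`, the `(2m+2)`-dimensional real Diamond
Lie algebra is an MD-algebra if and only if `m = 1`. -/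
theorem diamond_isMDAlgebra_iff (m : ℕ) (hm : 0 < m) :
    IsMDAlgebra (Diamond m) ↔ m = 1 := by
  constructor
  · intro h
    have hz := Diamond.two_mul_le_kirillovRank_zCoord m
    have hx := Diamond.kirillovRank_xCoord (⟨0, hm⟩ : Fin m)
    have := h (Diamond.zCoord m) (Diamond.xCoord ⟨0, hm⟩) (by omega) (by omega)
    omega
  · rintro rfl F G hF hG
    rw [Diamond.kirillovRank_eq_two hF, Diamond.kirillovRank_eq_two hG]
end

section
/- Let 𝔤 be a real Lie algebra of finite dimension n ≥ 3 whose derived ideal 𝔤¹ = [𝔤,𝔤] is 1-dimensional and contained in the center Z(𝔤). Then 𝔤 is decomposable (i.e., 𝔤 is the direct sum of two nonzero ideals) if and only if dim Z(𝔤) > 1. -/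
/-- A real Lie algebra is decomposable if it is the direct sum of two nonzero ideals. -/
def IsDecomposable (L : Type*) [LieRing L] [LieAlgebra ℝ L] : Prop :=
  ∃ I J : LieIdeal ℝ L, I ≠ ⊥ ∧ J ≠ ⊥ ∧ IsCompl I J

/-- Every Lie bracket lies in the derived ideal. -/
theorem lie_mem_derivedSeries_one {L : Type*} [LieRing L] [LieAlgebra ℝ L] (x y : L) :
    ⁅x, y⁆ ∈ LieAlgebra.derivedSeries ℝ L 1 := by
  rw [LieAlgebra.derivedSeries_def, LieAlgebra.derivedSeriesOfIdeal_succ,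
    LieAlgebra.derivedSeriesOfIdeal_zero]
  exact LieSubmodule.lie_mem_lie (LieSubmodule.mem_top x) (LieSubmodule.mem_top y)

/-- If the derived ideal is central, then every nonzero ideal meets the center. -/
theorem exists_ne_zero_mem_center_of_ne_bot {L : Type*} [LieRing L] [LieAlgebra ℝ L]
    (hc : LieAlgebra.derivedSeries ℝ L 1 ≤ LieAlgebra.center ℝ L)
    {I : LieIdeal ℝ L} (hI : I ≠ ⊥) :
    ∃ a ∈ I, a ∈ LieAlgebra.center ℝ L ∧ a ≠ 0 := by
  obtain ⟨x, hx, hx0⟩ := Submodule.exists_mem_ne_zero_of_ne_bot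
    fun h => hI (LieSubmodule.toSubmodule_injective h)
  by_cases h : ∀ y : L, ⁅y, x⁆ = 0
  · exact ⟨x, hx, (LieModule.mem_maxTrivSubmodule ℝ L L _).2 h, hx0⟩
  · obtain ⟨y, hy⟩ := not_forall.1 h
    exact ⟨⁅y, x⁆, I.lie_mem hx, hc (lie_mem_derivedSeries_one y x), hy⟩

/-- A decomposable Lie algebra with central derived ideal has center of dimension at least two. -/
theorem IsDecomposable.one_lt_finrank_center {L : Type*} [LieRing L] [LieAlgebra ℝ L]
    [Module.Finite ℝ L] (hc : LieAlgebra.derivedSeries ℝ L 1 ≤ LieAlgebra.center ℝ L)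
    (h : IsDecomposable L) : 1 < Module.finrank ℝ (LieAlgebra.center ℝ L) := by
  obtain ⟨I, J, hI, hJ, hIJ⟩ := h
  obtain ⟨a, haI, haZ, ha⟩ := exists_ne_zero_mem_center_of_ne_bot hc hI
  obtain ⟨b, hbJ, hbZ, hb⟩ := exists_ne_zero_mem_center_of_ne_bot hc hJ
  by_contra! hle
  obtain ⟨v, hv⟩ := finrank_le_one_iff.1 hle
  have mem_of_mem (K : LieIdeal ℝ L) (z : L) (hzK : z ∈ K)
      (hzZ : z ∈ LieAlgebra.center ℝ L) (hz : z ≠ 0) : (v : L) ∈ K := by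
    obtain ⟨c, hcz⟩ := hv ⟨z, hzZ⟩
    have hcz : c • (v : L) = z := congrArg Subtype.val hcz
    have hc0 : c ≠ 0 := by
      rintro rfl
      exact hz (by rw [← hcz, zero_smul])
    rw [← inv_smul_smul₀ hc0 (v : L), hcz]
    exact K.smul_mem _ hzK
  have hv0 : (v : L) ∈ I ⊓ J :=
    (LieSubmodule.mem_inf _ _ _).2 ⟨mem_of_mem I a haI haZ ha, mem_of_mem J b hbJ hbZ hb⟩
  rw [hIJ.inf_eq_bot, LieSubmodule.mem_bot] at hv0
  obtain ⟨c, hca⟩ := hv ⟨a, haZ⟩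
  have hca : c • (v : L) = a := congrArg Subtype.val hca
  exact ha (by rw [← hca, hv0, smul_zero])

/-- If the derived ideal is nonzero and properly contained in the center, then the Lie algebra is
decomposable. -/
theorem isDecomposable_of_derivedSeries_lt_center {L : Type*} [LieRing L] [LieAlgebra ℝ L]
    (h0 : LieAlgebra.derivedSeries ℝ L 1 ≠ ⊥)
    (hlt : LieAlgebra.derivedSeries ℝ L 1 < LieAlgebra.center ℝ L) : IsDecomposable L := by
  set D : Submodule ℝ L := (LieAlgebra.derivedSeries ℝ L 1).toSubmodule
  set Z : Submodule ℝ L := (LieAlgebra.center ℝ L).toSubmodule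
  have hDZ : D ≤ Z := hlt.le
  obtain ⟨C, hDC⟩ := exists_isCompl D
  have hdisj : Disjoint D (C ⊓ Z) := hDC.disjoint.mono_right inf_le_left
  obtain ⟨K, hDK, hK⟩ := hdisj.exists_isCompl
  let I : LieIdeal ℝ L :=
    { C ⊓ Z with
      lie_mem := by
        intro x m hm
        have : ⁅x, m⁆ = 0 := (LieModule.mem_maxTrivSubmodule ℝ L L _).1 hm.2 x
        rw [this]
        exact (C ⊓ Z).zero_mem }
  let J : LieIdeal ℝ L :=
    { K with lie_mem := fun {x m} _ => hDK (lie_mem_derivedSeries_one x m) }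
  refine ⟨I, J, fun hI => ?_, fun hJ => ?_, ?_⟩
  · have hCZ : C ⊓ Z = ⊥ := congrArg LieSubmodule.toSubmodule hI
    have hmod : (D ⊔ C) ⊓ Z = D ⊔ C ⊓ Z := sup_inf_assoc_of_le C hDZ
    rw [hCZ, hDC.sup_eq_top, top_inf_eq, sup_bot_eq] at hmod
    exact hlt.ne (LieSubmodule.toSubmodule_injective hmod.symm)
  · have hKbot : K = ⊥ := congrArg LieSubmodule.toSubmodule hJ
    exact h0 (LieSubmodule.toSubmodule_injective (le_bot_iff.1 (hDK.trans_eq hKbot)))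
  · exact (LieSubmodule.isCompl_toSubmodule).1 hK.symm

/-- Let `𝔤` be a real Lie algebra of finite dimension `n ≥ 3` whose derived
ideal is 1-dimensional and contained in the center. Then `𝔤` is decomposable if and only if
`dim Z(𝔤) > 1`. -/
theorem decomposable_iff_center_dim_gt_one
    {L : Type*} [LieRing L] [LieAlgebra ℝ L] [Module.Finite ℝ L]
    (n : ℕ) (hn : 3 ≤ n) (hdim : Module.finrank ℝ L = n)
    (hder : Module.finrank ℝ (LieAlgebra.derivedSeries ℝ L 1) = 1)
    (hc : LieAlgebra.derivedSeries ℝ L 1 ≤ LieAlgebra.center ℝ L) :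
    IsDecomposable L ↔ 1 < Module.finrank ℝ (LieAlgebra.center ℝ L) := by
  refine ⟨fun h => h.one_lt_finrank_center hc, fun h => ?_⟩
  refine isDecomposable_of_derivedSeries_lt_center (fun h0 => ?_) (hc.lt_of_ne fun heq => ?_)
  · rw [h0] at hder
    exact one_ne_zero (hder.symm.trans (finrank_bot ℝ L))
  · rw [← heq] at h
    exact h.ne' hder
end

section
/- Fix n ≥ 3 and, for an invertible real (n−1)×(n−1) matrix A, let 𝔤_A denote the real Lie algebra on (Fin (n−1) → ℝ) × ℝ with bracket [(x,s),(y,t)]_A = (s·A y − t·A x, 0). Then for invertible real (n−1)×(n−1) matrices A and B, the Lie algebras 𝔤_A and 𝔤_B are isomorphic as real Lie algebras if and only if there exist a nonzero real number c and an invertible real (n−1)×(n−1) matrix C such that c·A = C B C⁻¹ (i.e., A and B are proportional similar). -/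
open Matrix

/-- For a real `k × k` matrix `A`, the Lie algebra `𝔤_A` on the vector space
`(Fin k → ℝ) × ℝ` with bracket `[(x,s),(y,t)] = (s • A y − t • A x, 0)`. -/
def MatLie {k : ℕ} (A : Matrix (Fin k) (Fin k) ℝ) : Type :=
  (Fin k → ℝ) × ℝ

namespace MatLie

variable {k : ℕ} (A : Matrix (Fin k) (Fin k) ℝ)

noncomputable instance : AddCommGroup (MatLie A) :=
  inferInstanceAs (AddCommGroup ((Fin k → ℝ) × ℝ))
noncomputable instance : Module ℝ (MatLie A) :=
  inferInstanceAs (Module ℝ ((Fin k → ℝ) × ℝ))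

noncomputable instance : LieRing (MatLie A) where
  bracket x y := (x.2 • A.mulVec y.1 - y.2 • A.mulVec x.1, 0)
  add_lie x y z := by
    refine Prod.ext ?_ ?_
    · show (x.2 + y.2) • A.mulVec z.1 - z.2 • A.mulVec (x.1 + y.1) =
        (x.2 • A.mulVec z.1 - z.2 • A.mulVec x.1) + (y.2 • A.mulVec z.1 - z.2 • A.mulVec y.1)
      rw [Matrix.mulVec_add]
      module
    · show (0:ℝ) = 0 + 0; simp
  lie_add x y z := by
    refine Prod.ext ?_ ?_
    · show x.2 • A.mulVec (y.1 + z.1) - (y.2 + z.2) • A.mulVec x.1 =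
        (x.2 • A.mulVec y.1 - y.2 • A.mulVec x.1) + (x.2 • A.mulVec z.1 - z.2 • A.mulVec x.1)
      rw [Matrix.mulVec_add]
      module
    · show (0:ℝ) = 0 + 0; simp
  lie_self x := by
    refine Prod.ext ?_ ?_
    · show x.2 • A.mulVec x.1 - x.2 • A.mulVec x.1 = 0; simp
    · rfl
  leibniz_lie x y z := by
    refine Prod.ext ?_ ?_
    · show x.2 • A.mulVec (y.2 • A.mulVec z.1 - z.2 • A.mulVec y.1) -
          (0:ℝ) • A.mulVec x.1 =
        ((0:ℝ) • A.mulVec z.1 - z.2 • A.mulVec (x.2 • A.mulVec y.1 - y.2 • A.mulVec x.1)) +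
        (y.2 • A.mulVec (x.2 • A.mulVec z.1 - z.2 • A.mulVec x.1) - (0:ℝ) • A.mulVec y.1)
      rw [Matrix.mulVec_sub, Matrix.mulVec_sub, Matrix.mulVec_sub,
        Matrix.mulVec_smul, Matrix.mulVec_smul, Matrix.mulVec_smul, Matrix.mulVec_smul,
        Matrix.mulVec_smul, Matrix.mulVec_smul]
      module
    · show (0:ℝ) = 0 + 0; simp

noncomputable instance : LieAlgebra ℝ (MatLie A) where
  lie_smul c x y := by
    refine Prod.ext ?_ ?_
    · show x.2 • A.mulVec (c • y.1) - (c * y.2) • A.mulVec x.1 =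
        c • (x.2 • A.mulVec y.1 - y.2 • A.mulVec x.1)
      rw [Matrix.mulVec_smul]
      module
    · show (0:ℝ) = c • 0; simp

end MatLie

namespace MatLie

variable {k : ℕ} {A B : Matrix (Fin k) (Fin k) ℝ}

/-- The inclusion of the abelian ideal `Fin k → ℝ` into `𝔤_A`. -/
noncomputable def inl (A : Matrix (Fin k) (Fin k) ℝ) : (Fin k → ℝ) →ₗ[ℝ] MatLie A :=
  LinearMap.inl ℝ (Fin k → ℝ) ℝ

/-- The projection of `𝔤_A` onto the abelian ideal `Fin k → ℝ`. -/
noncomputable def fst (A : Matrix (Fin k) (Fin k) ℝ) : MatLie A →ₗ[ℝ] (Fin k → ℝ) :=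
  LinearMap.fst ℝ (Fin k → ℝ) ℝ

/-- The element `(0, 1)` of `𝔤_A`, which acts on the abelian ideal by `A`. -/
def gen (A : Matrix (Fin k) (Fin k) ℝ) : MatLie A :=
  ((0, 1) : (Fin k → ℝ) × ℝ)

lemma lie_inl (u : MatLie A) (x : Fin k → ℝ) : ⁅u, inl A x⁆ = inl A (u.2 • A *ᵥ x) := by
  refine Prod.ext ?_ rfl
  change u.2 • A *ᵥ x - (0 : ℝ) • A *ᵥ u.1 = u.2 • A *ᵥ x
  simp

lemma gen_lie_inl (x : Fin k → ℝ) : ⁅gen A, inl A x⁆ = inl A (A *ᵥ x) := by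
  rw [lie_inl]
  exact congrArg (inl A) (one_smul ℝ _)

/-- When `A` is invertible, the abelian ideal of `𝔤_A` is the derived algebra, hence it is
preserved by Lie algebra homomorphisms. -/
lemma map_inl (hA : IsUnit A) (f : MatLie A →ₗ⁅ℝ⁆ MatLie B) (x : Fin k → ℝ) :
    f (inl A x) = inl B (fst B (f (inl A x))) := by
  have hx : inl A x = ⁅gen A, inl A (A⁻¹ *ᵥ x)⁆ := by
    rw [gen_lie_inl, mulVec_mulVec, mul_nonsing_inv _ ((isUnit_iff_isUnit_det A).mp hA),
      one_mulVec]
  refine Prod.ext rfl ?_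
  rw [hx, LieHom.map_lie]
  rfl

/-- The matrix by which a Lie algebra homomorphism acts on the abelian ideals. -/
noncomputable def idealMatrix (f : MatLie A →ₗ⁅ℝ⁆ MatLie B) : Matrix (Fin k) (Fin k) ℝ :=
  LinearMap.toMatrix' (fst B ∘ₗ (f : MatLie A →ₗ[ℝ] MatLie B) ∘ₗ inl A)

lemma inl_idealMatrix_mulVec (hA : IsUnit A) (f : MatLie A →ₗ⁅ℝ⁆ MatLie B) (x : Fin k → ℝ) :
    inl B (idealMatrix f *ᵥ x) = f (inl A x) := by
  rw [idealMatrix, LinearMap.toMatrix'_mulVec, map_inl hA f x]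
  rfl

lemma inl_injective : Function.Injective (inl A) := fun _ _ h => congrArg (fst A) h

lemma idealMatrix_symm_mul (hA : IsUnit A) (hB : IsUnit B) (f : MatLie A ≃ₗ⁅ℝ⁆ MatLie B) :
    idealMatrix f.symm.toLieHom * idealMatrix f.toLieHom = 1 := by
  refine ext_of_mulVec_single fun i => inl_injective (A := A) ?_
  rw [← mulVec_mulVec, inl_idealMatrix_mulVec hB, inl_idealMatrix_mulVec hA, one_mulVec]
  exact f.symm_apply_apply _

lemma idealMatrix_mul (hA : IsUnit A) (f : MatLie A →ₗ⁅ℝ⁆ MatLie B) :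
    idealMatrix f * A = (f (gen A)).2 • (B * idealMatrix f) := by
  refine ext_of_mulVec_single fun i => inl_injective (A := B) ?_
  rw [← mulVec_mulVec, inl_idealMatrix_mulVec hA, ← gen_lie_inl, LieHom.map_lie,
    ← inl_idealMatrix_mulVec hA, lie_inl, mulVec_mulVec, smul_mulVec]

/-- The isomorphism `(x, s) ↦ (C⁻¹ x, c⁻¹ s)` of Lie algebras when `c A = C B C⁻¹`. -/
noncomputable def equivOfSimilar {c : ℝ} {C : Matrix (Fin k) (Fin k) ℝ} (hc : c ≠ 0)
    (hC : IsUnit C) (h : c • A = C * B * C⁻¹) : MatLie A ≃ₗ⁅ℝ⁆ MatLie B where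
  toFun x := ((C⁻¹ *ᵥ x.1, c⁻¹ * x.2) : (Fin k → ℝ) × ℝ)
  invFun x := ((C *ᵥ x.1, c * x.2) : (Fin k → ℝ) × ℝ)
  map_add' x y := Prod.ext (mulVec_add C⁻¹ x.1 y.1) (mul_add _ _ _)
  map_smul' r x := Prod.ext (mulVec_smul C⁻¹ r x.1) (mul_left_comm _ _ _)
  left_inv x := by
    have hdet := (isUnit_iff_isUnit_det C).mp hC
    refine Prod.ext ?_ ?_
    · change C *ᵥ C⁻¹ *ᵥ x.1 = x.1
      rw [mulVec_mulVec, mul_nonsing_inv _ hdet, one_mulVec]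
    · exact mul_inv_cancel_left₀ hc x.2
  right_inv x := by
    have hdet := (isUnit_iff_isUnit_det C).mp hC
    refine Prod.ext ?_ ?_
    · change C⁻¹ *ᵥ C *ᵥ x.1 = x.1
      rw [mulVec_mulVec, nonsing_inv_mul _ hdet, one_mulVec]
    · exact inv_mul_cancel_left₀ hc x.2
  map_lie' {x y} := by
    have hdet := (isUnit_iff_isUnit_det C).mp hC
    have hCA : C⁻¹ * A = c⁻¹ • (B * C⁻¹) := by
      rw [eq_inv_smul_iff₀ hc, ← Matrix.mul_smul, h, mul_assoc, nonsing_inv_mul_cancel_left _ _ hdet]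
    refine Prod.ext ?_ (mul_zero _)
    change C⁻¹ *ᵥ (x.2 • A *ᵥ y.1 - y.2 • A *ᵥ x.1) =
      (c⁻¹ * x.2) • B *ᵥ C⁻¹ *ᵥ y.1 - (c⁻¹ * y.2) • B *ᵥ C⁻¹ *ᵥ x.1
    simp only [mulVec_sub, mulVec_smul, mulVec_mulVec, hCA, smul_mulVec, smul_smul, mul_comm]

end MatLie

/-- For `n ≥ 3` and invertible real `(n-1) × (n-1)` matrices `A` and `B`,
the Lie algebras `𝔤_A` and `𝔤_B` are isomorphic if and only if `A` and `B` are proportional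
similar, i.e. `c • A = C B C⁻¹` for some nonzero real `c` and invertible matrix `C`. -/
theorem matLie_isomorphic_iff (n : ℕ) (hn : 3 ≤ n)
    (A B : Matrix (Fin (n - 1)) (Fin (n - 1)) ℝ) (hA : IsUnit A) (hB : IsUnit B) :
    Nonempty (MatLie A ≃ₗ⁅ℝ⁆ MatLie B) ↔
      ∃ (c : ℝ) (C : Matrix (Fin (n - 1)) (Fin (n - 1)) ℝ),
        c ≠ 0 ∧ IsUnit C ∧ c • A = C * B * C⁻¹ := by
  constructor
  · rintro ⟨f⟩
    have : NeZero (n - 1) := ⟨by omega⟩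
    set P := MatLie.idealMatrix f.toLieHom
    have hQP := MatLie.idealMatrix_symm_mul hA hB f
    have hP : IsUnit P := IsUnit.of_mul_eq_one_right _ hQP
    have hdet := (isUnit_iff_isUnit_det P).mp hP
    have hPA := MatLie.idealMatrix_mul hA f.toLieHom
    set d : ℝ := (f.toLieHom (MatLie.gen A)).2
    have hd : d ≠ 0 := fun hd => (hP.mul hA).ne_zero (by rw [hPA, hd, zero_smul])
    refine ⟨d⁻¹, P⁻¹, inv_ne_zero hd, isUnit_nonsing_inv_iff.mpr hP, ?_⟩
    rw [nonsing_inv_nonsing_inv _ hdet, inv_smul_eq_iff₀ hd, mul_assoc, ← Matrix.mul_smul, ← hPA,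
      nonsing_inv_mul_cancel_left _ _ hdet]
  · rintro ⟨c, C, hc, hC, h⟩
    exact ⟨MatLie.equivOfSimilar hc hC h⟩
end
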